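/- (Vorticity dynamics for LAMHD-α.) Let u_s, B_s, π solve the LAMHD-α system with viscosity ν and any diffusivity η. Define the vorticity ω = curl u and the current J = curl B. Then at every point, ∂_t ω + (u_s·∇)ω − (ω·∇)u_s = (B_s·∇)J − (J·∇)B_s + νΔω. -/

import Mathlib

open Matrix MeasureTheory

noncomputable section

abbrev V3 := Fin 3 → ℝ

/-- Partial derivative `∂_j f` of a scalar field on ℝ³. -/
def pd (j : Fin 3) (f : V3 → ℝ) (x : V3) : ℝ := fderiv ℝ f x (Pi.single j 1)

/-- Jacobian matrix field: `(∇f)_{ij} = ∂f_i/∂x_j`. -/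
def grad (f : V3 → V3) (x : V3) : Matrix (Fin 3) (Fin 3) ℝ :=
  Matrix.of fun i j => pd j (fun y => f y i) x

/-- Divergence of a vector field. -/
def divV (f : V3 → V3) (x : V3) : ℝ := ∑ j, pd j (fun y => f y j) x

/-- Divergence of a matrix field: `(div M)_i = Σ_j ∂_j M_{ij}`. -/
def divM (M : V3 → Matrix (Fin 3) (Fin 3) ℝ) (x : V3) (i : Fin 3) : ℝ :=
  ∑ j, pd j (fun y => M y i j) x

/-- Scalar Laplacian. -/
def lapS (φ : V3 → ℝ) (x : V3) : ℝ := ∑ j, pd j (fun y => pd j φ y) x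

/-- Componentwise Laplacian of a vector field. -/
def lap (f : V3 → V3) (x : V3) (i : Fin 3) : ℝ := lapS (fun y => f y i) x

/-- Helmholtz operator `(1 - α²Δ)` on vector fields. -/
def helm (α : ℝ) (f : V3 → V3) (x : V3) (i : Fin 3) : ℝ := f x i - α ^ 2 * lap f x i

/-- Helmholtz operator `(1 - α²Δ)` on scalar fields. -/
def helmS (α : ℝ) (φ : V3 → ℝ) (x : V3) : ℝ := φ x - α ^ 2 * lapS φ x

/-- Advection `(g·∇)f = Σ_j g_j ∂_j f`. -/
def advect (g f : V3 → V3) (x : V3) (i : Fin 3) : ℝ :=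
  ∑ j, g x j * pd j (fun y => f y i) x

/-- `(∇f)ᵀ·g`, pointwise matrix-vector product. -/
def gradTvec (f g : V3 → V3) (x : V3) (i : Fin 3) : ℝ :=
  ∑ j, (grad f x)ᵀ i j * g x j

/-- Gradient of a scalar field. -/
def gradS (φ : V3 → ℝ) (x : V3) (i : Fin 3) : ℝ := pd i φ x

/-- Pointwise squared Euclidean norm `|f|²`. -/
def normSq (f : V3 → V3) (x : V3) : ℝ := ∑ i, (f x i) ^ 2

/-- Squared Frobenius norm of the Jacobian, `|∇f|²`. -/
def gradNormSq (f : V3 → V3) (x : V3) : ℝ := ∑ i, ∑ j, (grad f x i j) ^ 2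

/-- Spatial tslice at time `t` of a time-dependent vector field. -/
def tslice (f : ℝ × V3 → V3) (t : ℝ) : V3 → V3 := fun x => f (t, x)

/-- Three-dimensional curl of a vector field. -/
def curl (f : V3 → V3) (x : V3) : V3 :=
  ![pd 1 (fun y => f y 2) x - pd 2 (fun y => f y 1) x,
    pd 2 (fun y => f y 0) x - pd 0 (fun y => f y 2) x,
    pd 0 (fun y => f y 1) x - pd 1 (fun y => f y 0) x]

theorem pd_add (j : Fin 3) {f g : V3 → ℝ} (hf : ContDiff ℝ (⊤ : ℕ∞) f)
    (hg : ContDiff ℝ (⊤ : ℕ∞) g) (x : V3) :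
    pd j (fun y => f y + g y) x = pd j f x + pd j g x := by
  simp only [pd]
  rw [fderiv_fun_add (hf.differentiable (by simp) x) (hg.differentiable (by simp) x)]
  rfl

theorem pd_sub (j : Fin 3) {f g : V3 → ℝ} (hf : ContDiff ℝ (⊤ : ℕ∞) f)
    (hg : ContDiff ℝ (⊤ : ℕ∞) g) (x : V3) :
    pd j (fun y => f y - g y) x = pd j f x - pd j g x := by
  simp only [pd]
  rw [fderiv_fun_sub (hf.differentiable (by simp) x) (hg.differentiable (by simp) x)]
  rfl

theorem pd_mul (j : Fin 3) {f g : V3 → ℝ} (hf : ContDiff ℝ (⊤ : ℕ∞) f)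
    (hg : ContDiff ℝ (⊤ : ℕ∞) g) (x : V3) :
    pd j (fun y => f y * g y) x = f x * pd j g x + g x * pd j f x := by
  simp only [pd]
  rw [fderiv_fun_mul (hf.differentiable (by simp) x) (hg.differentiable (by simp) x)]
  simp

theorem pd_const_mul (j : Fin 3) (c : ℝ) {f : V3 → ℝ} (hf : ContDiff ℝ (⊤ : ℕ∞) f) (x : V3) :
    pd j (fun y => c * f y) x = c * pd j f x := by
  simp only [pd]
  rw [fderiv_const_mul (hf.differentiable (by simp) x)]
  simp

/-- The directional derivative of a smooth function along a fixed vector is smooth. -/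
theorem contDiff_fderiv_apply_const {E : Type*} [NormedAddCommGroup E] [NormedSpace ℝ E]
    {f : E → ℝ} (hf : ContDiff ℝ (⊤ : ℕ∞) f) (v : E) :
    ContDiff ℝ (⊤ : ℕ∞) (fun x => fderiv ℝ f x v) :=
  (hf.fderiv_right (m := (⊤ : ℕ∞)) (by simp)).clm_apply contDiff_const

/-- Directional derivatives of a smooth function along fixed vectors commute. -/
theorem fderiv_fderiv_apply_comm {E : Type*} [NormedAddCommGroup E] [NormedSpace ℝ E]
    {f : E → ℝ} (hf : ContDiff ℝ (⊤ : ℕ∞) f) (v w x : E) :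
    fderiv ℝ (fun y => fderiv ℝ f y v) x w = fderiv ℝ (fun y => fderiv ℝ f y w) x v := by
  have hd : DifferentiableAt ℝ (fderiv ℝ f) x :=
    (hf.fderiv_right (m := (⊤ : ℕ∞)) (by simp)).differentiable (by simp) x
  have hs : IsSymmSndFDerivAt ℝ f x := hf.contDiffAt.isSymmSndFDerivAt (by
    simp only [minSmoothness_of_isRCLikeNormedField]
    exact WithTop.coe_le_coe.2 (le_top : (2 : ℕ∞) ≤ ⊤))
  rw [fderiv_clm_apply hd (differentiableAt_const v), fderiv_clm_apply hd (differentiableAt_const w)]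
  simpa using hs.eq w v

theorem contDiff_pd (j : Fin 3) {f : V3 → ℝ} (hf : ContDiff ℝ (⊤ : ℕ∞) f) :
    ContDiff ℝ (⊤ : ℕ∞) (fun x => pd j f x) :=
  contDiff_fderiv_apply_const hf _

theorem pd_comm (j k : Fin 3) {f : V3 → ℝ} (hf : ContDiff ℝ (⊤ : ℕ∞) f) (x : V3) :
    pd j (fun y => pd k f y) x = pd k (fun y => pd j f y) x :=
  fderiv_fderiv_apply_comm hf _ _ x

/-- A spatial partial derivative is a directional derivative in space-time. -/
theorem pd_slice_eq_fderiv {f : ℝ × V3 → ℝ} (hf : ContDiff ℝ (⊤ : ℕ∞) f) (j : Fin 3) (t : ℝ)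
    (x : V3) : pd j (fun y => f (t, y)) x = fderiv ℝ f (t, x) (0, Pi.single j 1) := by
  have h := (hf.differentiable (by simp) (t, x)).hasFDerivAt.comp x (hasFDerivAt_prodMk_right t x)
  change fderiv ℝ (f ∘ fun y => (t, y)) x _ = _
  rw [h.fderiv]
  simp

/-- The time derivative is a directional derivative in space-time. -/
theorem hasDerivAt_time_slice {f : ℝ × V3 → ℝ} (hf : ContDiff ℝ (⊤ : ℕ∞) f) (t : ℝ) (x : V3) :
    HasDerivAt (fun s => f (s, x)) (fderiv ℝ f (t, x) (1, 0)) t := by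
  have h := (hf.differentiable (by simp) (t, x)).hasFDerivAt.comp_hasDerivAt t
    ((hasDerivAt_id t).prodMk (hasDerivAt_const t x))
  exact h

theorem contDiff_pd_slice {f : ℝ × V3 → ℝ} (hf : ContDiff ℝ (⊤ : ℕ∞) f) (j : Fin 3) :
    ContDiff ℝ (⊤ : ℕ∞) (fun p : ℝ × V3 => pd j (fun y => f (p.1, y)) p.2) := by
  simp only [pd_slice_eq_fderiv hf]
  exact contDiff_fderiv_apply_const hf _

/-- Space and time derivatives of a smooth function commute. -/
theorem hasDerivAt_pd_slice {f : ℝ × V3 → ℝ} (hf : ContDiff ℝ (⊤ : ℕ∞) f) (j : Fin 3) (t : ℝ)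
    (x : V3) :
    HasDerivAt (fun s => pd j (fun y => f (s, y)) x)
      (pd j (fun y => deriv (fun s => f (s, y)) t) x) t := by
  simp only [(hasDerivAt_time_slice hf t _).deriv,
    pd_slice_eq_fderiv (contDiff_fderiv_apply_const hf (1, 0)), pd_slice_eq_fderiv hf]
  rw [fderiv_fderiv_apply_comm hf]
  exact hasDerivAt_time_slice (contDiff_fderiv_apply_const hf _) t x

/-- The Helmholtz operator applied in space preserves joint smoothness. -/
theorem contDiff_helm_slice (α : ℝ) {f : ℝ × V3 → V3} (hf : ContDiff ℝ (⊤ : ℕ∞) f) (i : Fin 3) :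
    ContDiff ℝ (⊤ : ℕ∞) (fun p : ℝ × V3 => helm α (tslice f p.1) p.2 i) := by
  have hi : ContDiff ℝ (⊤ : ℕ∞) (fun p => f p i) := contDiff_pi.1 hf i
  simp only [helm, lap, lapS, tslice]
  exact hi.sub (contDiff_const.mul (ContDiff.sum fun j _ =>
    contDiff_pd_slice (contDiff_pd_slice hi j) j))

/-- The time derivative of the curl is the curl of the time derivative. -/
theorem deriv_curl_slice {f : ℝ → V3 → V3}
    (hf : ∀ i, ContDiff ℝ (⊤ : ℕ∞) (fun p : ℝ × V3 => f p.1 p.2 i)) (t : ℝ) (x : V3) (i : Fin 3) :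
    deriv (fun s => curl (f s) x i) t = curl (fun y k => deriv (fun s => f s y k) t) x i := by
  have h := fun j k => hasDerivAt_pd_slice (hf k) j t x
  fin_cases i
  · exact ((h 1 2).sub (h 2 1)).deriv
  · exact ((h 2 0).sub (h 0 2)).deriv
  · exact ((h 0 1).sub (h 1 0)).deriv

/-- Taking the curl of the momentum balance gives the vorticity balance. -/
theorem curl_momentum_balance (ν : ℝ) {w v u b B : V3 → V3} {p : V3 → ℝ}
    (hw : ∀ i, ContDiff ℝ (⊤ : ℕ∞) (fun x => w x i))
    (hv : ∀ i, ContDiff ℝ (⊤ : ℕ∞) (fun x => v x i))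
    (hu : ∀ i, ContDiff ℝ (⊤ : ℕ∞) (fun x => u x i))
    (hb : ∀ i, ContDiff ℝ (⊤ : ℕ∞) (fun x => b x i))
    (hB : ∀ i, ContDiff ℝ (⊤ : ℕ∞) (fun x => B x i))
    (hp : ContDiff ℝ (⊤ : ℕ∞) p)
    (hdivv : ∀ x, divV v x = 0) (hdivb : ∀ x, divV b x = 0)
    (hbal : ∀ x i, w x i + advect v u x i - advect b B x i + gradTvec v u x i
      + gradTvec B b x i + gradS p x i = ν * lap u x i) (x : V3) (i : Fin 3) :
    curl w x i + advect v (curl u) x i - advect (curl u) v x i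
      = advect b (curl B) x i - advect (curl B) b x i + ν * lap (curl u) x i := by
  have hpd : ∀ j (f : V3 → ℝ), ContDiff ℝ (⊤ : ℕ∞) f → ContDiff ℝ (⊤ : ℕ∞) (fun x => pd j f x) :=
    fun j f hf => contDiff_pd j hf
  have hdv := hdivv x
  have hdb := hdivb x
  have key : ∀ j i, pd j (fun x => w x i + advect v u x i - advect b B x i + gradTvec v u x i
      + gradTvec B b x i + gradS p x i) x = pd j (fun x => ν * lap u x i) x := by
    intro j i
    simp only [hbal]
  simp only [divV, Fin.sum_univ_three] at hdv hdb
  simp only [advect, gradTvec, grad, gradS, lap, lapS, Fin.sum_univ_three, Matrix.transpose_apply,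
    Matrix.of_apply] at key
  simp (disch := fun_prop (disch := assumption)) only [pd_const_mul] at key
  simp (disch := fun_prop (disch := assumption)) only [pd_add, pd_sub, pd_mul] at key
  have c10 : ∀ f : V3 → ℝ, ContDiff ℝ (⊤ : ℕ∞) f → ∀ x,
      pd 1 (fun y => pd 0 f y) x = pd 0 (fun y => pd 1 f y) x := fun f hf => pd_comm 1 0 hf
  have c20 : ∀ f : V3 → ℝ, ContDiff ℝ (⊤ : ℕ∞) f → ∀ x,
      pd 2 (fun y => pd 0 f y) x = pd 0 (fun y => pd 2 f y) x := fun f hf => pd_comm 2 0 hf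
  have c21 : ∀ f : V3 → ℝ, ContDiff ℝ (⊤ : ℕ∞) f → ∀ x,
      pd 2 (fun y => pd 1 f y) x = pd 1 (fun y => pd 2 f y) x := fun f hf => pd_comm 2 1 hf
  have k01 := key 0 1
  have k02 := key 0 2
  have k10 := key 1 0
  have k12 := key 1 2
  have k20 := key 2 0
  have k21 := key 2 1
  simp (disch := fun_prop (disch := assumption)) only [c10, c20, c21]
    at k01 k02 k10 k12 k20 k21
  fin_cases i <;>
    simp only [curl, advect, lap, lapS, Fin.sum_univ_three, Fin.zero_eta, Fin.mk_one,
      Fin.reduceFinMk, Matrix.cons_val] <;>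
    simp (disch := fun_prop (disch := assumption)) only [pd_sub, c10, c20, c21]
  · linear_combination k12 - k21
      - (pd 1 (fun y => u y 2) x - pd 2 (fun y => u y 1) x) * hdv
      + (pd 1 (fun y => B y 2) x - pd 2 (fun y => B y 1) x) * hdb
  · linear_combination k20 - k02
      - (pd 2 (fun y => u y 0) x - pd 0 (fun y => u y 2) x) * hdv
      + (pd 2 (fun y => B y 0) x - pd 0 (fun y => B y 2) x) * hdb
  · linear_combination k01 - k10
      - (pd 0 (fun y => u y 1) x - pd 1 (fun y => u y 0) x) * hdv
      + (pd 0 (fun y => B y 1) x - pd 1 (fun y => B y 0) x) * hdb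

/-- vorticity dynamics for LAMHD-α, with `ω = curl u` and `J = curl B`. -/
theorem lamhd_vorticity_dynamics (α : ℝ) (hα : 0 ≤ α) (ν η : ℝ)
    (us Bs : ℝ × V3 → V3) (pres : ℝ × V3 → ℝ)
    (hus : ContDiff ℝ (⊤ : ℕ∞) us) (hBs : ContDiff ℝ (⊤ : ℕ∞) Bs) (hpres : ContDiff ℝ (⊤ : ℕ∞) pres)
    (hdivu : ∀ t : ℝ, ∀ x : V3, divV (tslice us t) x = 0)
    (hdivB : ∀ t : ℝ, ∀ x : V3, divV (tslice Bs t) x = 0)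
    (hmotion : ∀ t : ℝ, ∀ x : V3, ∀ i : Fin 3,
      deriv (fun s => helm α (tslice us s) x i) t
        + advect (tslice us t) (helm α (tslice us t)) x i
        - advect (tslice Bs t) (helm α (tslice Bs t)) x i
        + gradTvec (tslice us t) (helm α (tslice us t)) x i
        + gradTvec (helm α (tslice Bs t)) (tslice Bs t) x i
        + gradS (fun y => pres (t, y)) x i
        = ν * lap (helm α (tslice us t)) x i)
    (hinduction : ∀ t : ℝ, ∀ x : V3, ∀ i : Fin 3,
      deriv (fun s => Bs (s, x) i) t
        + advect (tslice us t) (tslice Bs t) x i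
        - advect (tslice Bs t) (tslice us t) x i
        = η * lap (helm α (tslice Bs t)) x i) :
    ∀ t : ℝ, ∀ x : V3, ∀ i : Fin 3,
      deriv (fun s => curl (helm α (tslice us s)) x i) t
        + advect (tslice us t) (curl (helm α (tslice us t))) x i
        - advect (curl (helm α (tslice us t))) (tslice us t) x i
      = advect (tslice Bs t) (curl (helm α (tslice Bs t))) x i
        - advect (curl (helm α (tslice Bs t))) (tslice Bs t) x i
        + ν * lap (curl (helm α (tslice us t))) x i := by
  intro t x i
  have hU := contDiff_helm_slice α hus
  have hB := contDiff_helm_slice α hBs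
  have hslice : ∀ {f : ℝ × V3 → ℝ}, ContDiff ℝ (⊤ : ℕ∞) f →
      ContDiff ℝ (⊤ : ℕ∞) (fun y => f (t, y)) := fun hf => hf.comp (contDiff_prodMk_right t)
  rw [deriv_curl_slice hU]
  refine curl_momentum_balance ν (p := fun y => pres (t, y)) (fun i => ?_)
    (fun i => hslice (contDiff_pi.1 hus i)) (fun i => hslice (hU i))
    (fun i => hslice (contDiff_pi.1 hBs i)) (fun i => hslice (hB i)) (hslice hpres)
    (hdivu t) (hdivB t) (hmotion t) x i
  simp only [(hasDerivAt_time_slice (hU i) t _).deriv]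
  exact hslice (contDiff_fderiv_apply_const (hU i) _)
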